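/- Suppose u ∈ C²(U) solves −Δu = a(x)·f(u) + a₀(x) on an open set U ⊂ ℝ² with a, a₀ ∈ C¹(U). Then for any ball B ⋐ U centered at the origin, the Pohozaev identity holds: ∫_B [2(a F(u) + a₀ u) + (y·∇a) F(u) + (y·∇a₀) u] dy = ∫_{∂B} [(y·∇u)(∂u/∂ν) − (y·ν)|∇u|²/2 + (y·ν)(a F(u) + a₀ u)] ds, where F(u) = ∫₀^u f(s) ds and ν is the outward unit normal. -/

import Mathlib

open MeasureTheory Real RealInnerProductSpace

/-- The Euclidean Laplacian on `ℝ²`, written as the sum of second partial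
derivatives in the coordinate directions. -/
noncomputable def laplacian2 (u : EuclideanSpace ℝ (Fin 2) → ℝ)
    (y : EuclideanSpace ℝ (Fin 2)) : ℝ :=
  ∑ i : Fin 2,
    fderiv ℝ (fun z => fderiv ℝ u z (EuclideanSpace.single i 1)) y
      (EuclideanSpace.single i 1)

/-- The point of the plane with polar coordinates `(r, θ)`. -/
noncomputable def polarPoint (r θ : ℝ) : EuclideanSpace ℝ (Fin 2) :=
  !₂[r * cos θ, r * sin θ]

lemma continuous_polarPoint (r : ℝ) : Continuous (polarPoint r) := by
  unfold polarPoint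
  fun_prop

lemma dist_polarPoint {r : ℝ} (hr : 0 ≤ r) (s t : ℝ) :
    dist (polarPoint r s) (polarPoint r t) = 2 * r * |sin ((s - t) / 2)| := by
  rw [EuclideanSpace.dist_eq, ← Real.sqrt_sq (by positivity : 0 ≤ 2 * r * |sin ((s - t) / 2)|)]
  congr 1
  simp only [polarPoint, Fin.sum_univ_two, Real.dist_eq, sq_abs, mul_pow]
  simp only [Matrix.cons_val_zero, Matrix.cons_val_one]
  have h : sin ((s - t) / 2) ^ 2 = 1 / 2 - cos (s - t) / 2 := by
    rw [sin_sq_eq_half_sub]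
    ring_nf
  rw [h, cos_sub]
  linear_combination r ^ 2 * (sin_sq_add_cos_sq s + sin_sq_add_cos_sq t)

lemma norm_polarPoint {r : ℝ} (hr : 0 ≤ r) (θ : ℝ) : ‖polarPoint r θ‖ = r := by
  rw [EuclideanSpace.norm_eq]
  conv_rhs => rw [← Real.sqrt_sq hr]
  congr 1
  simp only [polarPoint, Fin.sum_univ_two, Real.norm_eq_abs, sq_abs, mul_pow,
    Matrix.cons_val_zero, Matrix.cons_val_one]
  linear_combination r ^ 2 * sin_sq_add_cos_sq θ

lemma lipschitzWith_polarPoint {r : ℝ} (hr : 0 ≤ r) :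
    LipschitzWith r.toNNReal (polarPoint r) := by
  refine LipschitzWith.of_dist_le_mul fun s t => ?_
  rw [dist_polarPoint hr, Real.coe_toNNReal r hr, Real.dist_eq]
  have h : |sin ((s - t) / 2)| ≤ |s - t| / 2 := by
    simpa [abs_div] using abs_sin_le_abs (x := (s - t) / 2)
  nlinarith

lemma le_dist_polarPoint {r δ : ℝ} (hr : 0 ≤ r) {s t : ℝ} (h1 : δ ≤ 1) (hst : |s - t| ≤ δ) :
    r * (1 - δ) * |s - t| ≤ dist (polarPoint r s) (polarPoint r t) := by
  rw [dist_polarPoint hr]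
  have h := abs_sub_sin_le ((s - t) / 2)
  have h' := abs_sub_abs_le_abs_sub ((s - t) / 2) (sin ((s - t) / 2))
  rw [abs_div, abs_two] at h h'
  set x := |s - t|
  have hx : 0 ≤ x := abs_nonneg _
  have h3 : x ^ 2 ≤ δ := by nlinarith
  have h4 : x ^ 3 ≤ δ * x := by nlinarith
  have h5 : (1 - δ) * x ≤ 2 * |sin ((s - t) / 2)| := by nlinarith
  nlinarith

lemma exists_polarPoint_eq {r : ℝ} {y : EuclideanSpace ℝ (Fin 2)} (hy : ‖y‖ = r) :
    ∃ θ ∈ Set.Ioc (-π) π, polarPoint r θ = y := by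
  have hz : ‖(⟨y 0, y 1⟩ : ℂ)‖ = r := by
    rw [← hy, EuclideanSpace.norm_eq, Complex.norm_def, Complex.normSq_apply, Fin.sum_univ_two]
    simp [sq]
  refine ⟨Complex.arg ⟨y 0, y 1⟩, Complex.arg_mem_Ioc _, ?_⟩
  have h0 := Complex.norm_mul_cos_arg ⟨y 0, y 1⟩
  have h1 := Complex.norm_mul_sin_arg ⟨y 0, y 1⟩
  rw [hz] at h0 h1
  ext i
  fin_cases i
  · simpa [polarPoint] using h0
  · simpa [polarPoint] using h1

lemma injOn_polarPoint {r : ℝ} (hr : 0 < r) : Set.InjOn (polarPoint r) (Set.Ioc (-π) π) := by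
  intro s hs t ht h
  have h0 := congrArg (fun y : EuclideanSpace ℝ (Fin 2) => y 0) h
  have h1 := congrArg (fun y : EuclideanSpace ℝ (Fin 2) => y 1) h
  simp only [polarPoint, PiLp.toLp_apply, Matrix.cons_val_zero, Matrix.cons_val_one,
    mul_right_inj' hr.ne'] at h0 h1
  rw [← Complex.arg_cos_add_sin_mul_I hs, ← Complex.arg_cos_add_sin_mul_I ht,
    ← Complex.ofReal_cos, ← Complex.ofReal_sin, ← Complex.ofReal_cos, ← Complex.ofReal_sin, h0, h1]

/-- A curve that locally expands distances by at least `c` has length at least `c` times the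
length of its parameter set. -/
lemma mul_volume_le_hausdorffMeasure_image {X : Type*} [MetricSpace X] [MeasurableSpace X]
    [BorelSpace X] {γ : ℝ → X} (hγ : Continuous γ) {c : NNReal} {δ : ℝ} (hc : 0 < c) (hδ : 0 < δ)
    (h : ∀ s t, |s - t| ≤ δ → c * |s - t| ≤ dist (γ s) (γ t)) {A : Set ℝ} (hA : MeasurableSet A)
    (hinj : Set.InjOn γ A) : c * volume A ≤ μH[1] (γ '' A) := by
  set I : ℤ → Set ℝ := fun n => A ∩ Set.Ioc (n • δ) ((n + 1) • δ) with hI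
  have hIm : ∀ n, MeasurableSet (I n) := fun n => hA.inter measurableSet_Ioc
  have hIU : ⋃ n, I n = A := by
    rw [← Set.inter_iUnion, iUnion_Ioc_zsmul hδ, Set.inter_univ]
  have hIA : ∀ n, I n ⊆ A := fun n => Set.inter_subset_left
  have hId : Pairwise (Function.onFun Disjoint I) := fun m n hmn =>
    (Set.pairwise_disjoint_Ioc_zsmul δ hmn).mono Set.inter_subset_right Set.inter_subset_right
  have hle : ∀ n, c * volume (I n) ≤ μH[1] (γ '' I n) := by
    intro n
    have hanti : AntilipschitzWith c⁻¹ (fun x : I n => γ x) := by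
      refine AntilipschitzWith.of_le_mul_dist fun x y => ?_
      have hx := x.2.2
      have hy := y.2.2
      simp only [Set.mem_Ioc, zsmul_eq_mul, Int.cast_add, Int.cast_one] at hx hy
      have := h x y (abs_le.2 ⟨by linarith, by linarith⟩)
      rw [NNReal.coe_inv, ← div_eq_inv_mul, le_div_iff₀ (by exact_mod_cast hc), mul_comm,
        Subtype.dist_eq, Real.dist_eq]
      exact this
    have h1 := hanti.le_hausdorffMeasure_image zero_le_one Set.univ
    have h2 := (isometry_subtype_coe (s := I n)).hausdorffMeasure_image (d := 1)
      (Or.inl zero_le_one) Set.univ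
    rw [Set.image_univ, Subtype.range_coe, hausdorffMeasure_real] at h2
    rw [← h2, ENNReal.rpow_one] at h1
    have h3 : (fun x : I n => γ x) '' Set.univ = γ '' I n := by
      rw [Set.image_univ, Set.range_comp' γ, Subtype.range_coe]
    rw [h3, ENNReal.coe_inv hc.ne'] at h1
    calc c * volume (I n) ≤ c * ((c : ENNReal)⁻¹ * μH[1] (γ '' I n)) := by gcongr
      _ = μH[1] (γ '' I n) :=
        ENNReal.mul_inv_cancel_left (by exact_mod_cast hc.ne') ENNReal.coe_ne_top
  calc c * volume A = ∑' n, c * volume (I n) := by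
        rw [ENNReal.tsum_mul_left, ← measure_iUnion hId hIm, hIU]
    _ ≤ ∑' n, μH[1] (γ '' I n) := ENNReal.tsum_le_tsum hle
    _ = μH[1] (γ '' A) := by
        rw [← hIU, Set.image_iUnion, measure_iUnion]
        · intro m n hmn
          rw [Function.onFun, Set.disjoint_iff_inter_eq_empty,
            ← hinj.image_inter (hIA m) (hIA n), (hId hmn).inter_eq, Set.image_empty]
        · exact fun n => (hIm n).image_of_continuousOn_injOn hγ.continuousOn (hinj.mono (hIA n))

lemma hausdorffMeasure_polarPoint_image {r : ℝ} (hr : 0 < r) {A : Set ℝ} (hA : MeasurableSet A)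
    (hAs : A ⊆ Set.Ioc (-π) π) :
    μH[1] (polarPoint r '' A) = ENNReal.ofReal r * volume A := by
  refine le_antisymm ?_ ?_
  · have := (lipschitzWith_polarPoint hr.le).hausdorffMeasure_image_le zero_le_one A
    rwa [ENNReal.rpow_one, hausdorffMeasure_real] at this
  · have key : ∀ δ ∈ Set.Ioo (0 : ℝ) 1,
        ENNReal.ofReal (r * (1 - δ)) * volume A ≤ μH[1] (polarPoint r '' A) := by
      intro δ hδ
      have hpos : 0 < r * (1 - δ) := mul_pos hr (by linarith [hδ.2])
      refine mul_volume_le_hausdorffMeasure_image (continuous_polarPoint r)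
        (c := (r * (1 - δ)).toNNReal) (by simpa using hpos) hδ.1 (fun s t hst => ?_) hA
        ((injOn_polarPoint hr).mono hAs)
      rw [Real.coe_toNNReal _ hpos.le]
      exact le_dist_polarPoint hr.le hδ.2.le hst
    have hA' : volume A ≠ ⊤ := ((measure_mono hAs).trans_lt measure_Ioc_lt_top).ne
    have hlim : Filter.Tendsto (fun δ : ℝ => ENNReal.ofReal (r * (1 - δ)) * volume A)
        (nhdsWithin 0 (Set.Ioi 0)) (nhds (ENNReal.ofReal r * volume A)) := by
      refine ENNReal.Tendsto.mul_const ?_ (Or.inr hA')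
      refine (ENNReal.continuous_ofReal.comp
        (by fun_prop : Continuous fun δ : ℝ => r * (1 - δ))).tendsto' 0 _ (by simp) |>.mono_left
        nhdsWithin_le_nhds
    exact le_of_tendsto hlim
      (Filter.eventually_of_mem (Ioo_mem_nhdsGT one_pos) key)

lemma hausdorffMeasure_restrict_sphere {r : ℝ} (hr : 0 < r) :
    (μH[1] : Measure (EuclideanSpace ℝ (Fin 2))).restrict (Metric.sphere 0 r) =
      ENNReal.ofReal r • (volume.restrict (Set.Ioc (-π) π)).map (polarPoint r) := by
  have hm := (continuous_polarPoint r).measurable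
  ext S hS
  rw [Measure.restrict_apply hS, Measure.smul_apply, Measure.map_apply hm hS,
    Measure.restrict_apply (hm hS), smul_eq_mul,
    ← hausdorffMeasure_polarPoint_image hr ((hm hS).inter measurableSet_Ioc) Set.inter_subset_right]
  congr 1
  ext y
  simp only [Set.mem_inter_iff, mem_sphere_zero_iff_norm, Set.mem_image, Set.mem_preimage]
  constructor
  · rintro ⟨hy, hr'⟩
    obtain ⟨θ, hθ, rfl⟩ := exists_polarPoint_eq hr'
    exact ⟨θ, ⟨hy, hθ⟩, rfl⟩
  · rintro ⟨θ, ⟨hy, -⟩, rfl⟩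
    exact ⟨hy, norm_polarPoint hr.le θ⟩

lemma integral_sphere_eq {r : ℝ} (hr : 0 < r) {g : EuclideanSpace ℝ (Fin 2) → ℝ}
    (hg : ContinuousOn g (Metric.sphere 0 r)) :
    ∫ y in Metric.sphere (0 : EuclideanSpace ℝ (Fin 2)) r, g y ∂μH[1] =
      ∫ θ in -π..π, r * g (polarPoint r θ) := by
  have hmeas := hg.aestronglyMeasurable (μ := μH[1]) Metric.isClosed_sphere.measurableSet
  have h0 : ENNReal.ofReal r ≠ 0 := by simpa using hr
  rw [hausdorffMeasure_restrict_sphere hr] at hmeas ⊢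
  replace hmeas := hmeas.mono_ac (Measure.absolutelyContinuous_smul h0)
  rw [integral_smul_measure, integral_map (continuous_polarPoint r).aemeasurable hmeas,
    ENNReal.toReal_ofReal hr.le, smul_eq_mul, intervalIntegral.integral_const_mul,
    intervalIntegral.integral_of_le (by linarith [pi_pos])]

lemma setIntegral_ball_eq_polar (R : ℝ) (g : EuclideanSpace ℝ (Fin 2) → ℝ) :
    ∫ y in Metric.ball (0 : EuclideanSpace ℝ (Fin 2)) R, g y =
      ∫ p in Set.Icc ((0, -π) : ℝ × ℝ) (R, π), p.1 * g (polarPoint p.1 p.2) := by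
  let e : ℝ × ℝ ≃ᵐ EuclideanSpace ℝ (Fin 2) :=
    MeasurableEquiv.finTwoArrow.symm.trans (MeasurableEquiv.toLp 2 (Fin 2 → ℝ))
  have he : MeasurePreserving e :=
    (PiLp.volume_preserving_toLp (Fin 2)).comp (volume_preserving_finTwoArrow ℝ).symm
  have hpolar : ∀ p : ℝ × ℝ, e (polarCoord.symm p) = polarPoint p.1 p.2 := fun p => rfl
  rw [← integral_indicator Metric.isOpen_ball.measurableSet,
    ← he.integral_comp e.measurableEmbedding, ← integral_comp_polarCoord_symm,
    ← integral_indicator polarCoord.open_target.measurableSet]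
  have hIoo : Set.Icc ((0, -π) : ℝ × ℝ) (R, π) =ᵐ[volume]
      (Set.Ioo 0 R ×ˢ Set.Ioo (-π) π : Set (ℝ × ℝ)) := by
    rw [← Set.Icc_prod_Icc]
    exact Measure.set_prod_ae_eq Ioo_ae_eq_Icc.symm Ioo_ae_eq_Icc.symm
  rw [setIntegral_congr_set hIoo,
    ← integral_indicator (measurableSet_Ioo.prod measurableSet_Ioo)]
  congr 1
  ext p
  simp only [hpolar]
  by_cases h0 : 0 < p.1
  · by_cases h1 : p.1 < R <;> by_cases h2 : p.2 ∈ Set.Ioo (-π) π <;>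
      simp [Set.indicator, norm_polarPoint h0.le, h0, h1, h2, polarCoord_target]
  · simp [Set.indicator, h0, polarCoord_target]

/-- The derivative of the polar coordinate map at `(r, θ)`. -/
noncomputable def polarPointDeriv (p : ℝ × ℝ) : ℝ × ℝ →L[ℝ] EuclideanSpace ℝ (Fin 2) :=
  (ContinuousLinearMap.fst ℝ ℝ ℝ).smulRight (polarPoint 1 p.2) +
    (ContinuousLinearMap.snd ℝ ℝ ℝ).smulRight (polarPoint p.1 (p.2 + π / 2))

lemma hasFDerivAt_polarPoint (p : ℝ × ℝ) :
    HasFDerivAt (fun p : ℝ × ℝ => polarPoint p.1 p.2) (polarPointDeriv p) p := by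
  rw [← hasFDerivWithinAt_univ, hasFDerivWithinAt_piLp]
  intro i
  rw [hasFDerivWithinAt_univ]
  have h1 : HasFDerivAt (fun p : ℝ × ℝ => p.1) (ContinuousLinearMap.fst ℝ ℝ ℝ) p := hasFDerivAt_fst
  have h2 : HasFDerivAt (fun p : ℝ × ℝ => p.2) (ContinuousLinearMap.snd ℝ ℝ ℝ) p := hasFDerivAt_snd
  fin_cases i
  · refine (h1.mul h2.cos).congr_fderiv ?_
    ext <;> simp [polarPointDeriv, polarPoint, cos_add_pi_div_two]
  · refine (h1.mul h2.sin).congr_fderiv ?_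
    ext <;> simp [polarPointDeriv, polarPoint, sin_add_pi_div_two]

lemma polarPoint_eq_sum (r θ : ℝ) : polarPoint r θ =
    (r * cos θ) • EuclideanSpace.single 0 1 + (r * sin θ) • EuclideanSpace.single 1 1 := by
  ext i
  fin_cases i <;> simp [polarPoint]

/-- **Divergence theorem** on a disk centred at the origin, for the vector field `(P, Q)`. -/
lemma integral_ball_divergence {U : Set (EuclideanSpace ℝ (Fin 2))} (hU : IsOpen U)
    {P Q : EuclideanSpace ℝ (Fin 2) → ℝ} {R : ℝ} (hR : 0 < R)
    (hB : Metric.closedBall (0 : EuclideanSpace ℝ (Fin 2)) R ⊆ U)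
    (hP : ContDiffOn ℝ 1 P U) (hQ : ContDiffOn ℝ 1 Q U) :
    ∫ y in Metric.ball (0 : EuclideanSpace ℝ (Fin 2)) R,
        (fderiv ℝ P y (EuclideanSpace.single 0 1) + fderiv ℝ Q y (EuclideanSpace.single 1 1)) =
      ∫ y in Metric.sphere (0 : EuclideanSpace ℝ (Fin 2)) R,
        R⁻¹ * (y 0 * P y + y 1 * Q y) ∂μH[1] := by
  set K : Set (ℝ × ℝ) := Set.Icc (0, -π) (R, π) with hK
  have hmaps : ∀ p ∈ K, polarPoint p.1 p.2 ∈ U := by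
    rintro p ⟨h1, h2⟩
    refine hB ?_
    rw [mem_closedBall_zero_iff, norm_polarPoint h1.1]
    exact h2.1
  have hcont : Continuous fun p : ℝ × ℝ => polarPoint p.1 p.2 :=
    continuous_iff_continuousAt.2 fun p => (hasFDerivAt_polarPoint p).continuousAt
  have hcomp : ∀ {g : EuclideanSpace ℝ (Fin 2) → ℝ}, ContinuousOn g U →
      ContinuousOn (fun p : ℝ × ℝ => g (polarPoint p.1 p.2)) K := fun hg =>
    hg.comp hcont.continuousOn hmaps
  have hderiv : ∀ {g : EuclideanSpace ℝ (Fin 2) → ℝ}, ContDiffOn ℝ 1 g U → ∀ p ∈ K,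
      HasFDerivAt (fun p : ℝ × ℝ => g (polarPoint p.1 p.2))
        ((fderiv ℝ g (polarPoint p.1 p.2)).comp (polarPointDeriv p)) p := fun hg p hp =>
    (((hg.differentiableOn one_ne_zero).differentiableAt
      (hU.mem_nhds (hmaps p hp))).hasFDerivAt.comp p (hasFDerivAt_polarPoint p) :)
  have hfd : ∀ {g : EuclideanSpace ℝ (Fin 2) → ℝ}, ContDiffOn ℝ 1 g U →
      ∀ v, ContinuousOn (fun y => fderiv ℝ g y v) U := fun hg v =>
    (hg.continuousOn_fderiv_of_isOpen hU le_rfl).clm_apply continuousOn_const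
  have h1 : ∀ p : ℝ × ℝ, HasFDerivAt (fun p : ℝ × ℝ => p.1) (ContinuousLinearMap.fst ℝ ℝ ℝ) p :=
    fun p => hasFDerivAt_fst
  have h2 : ∀ p : ℝ × ℝ, HasFDerivAt (fun p : ℝ × ℝ => p.2) (ContinuousLinearMap.snd ℝ ℝ ℝ) p :=
    fun p => hasFDerivAt_snd
  have hKo : Set.Ioo 0 R ×ˢ Set.Ioo (-π) π ⊆ K := by
    rw [hK, ← Set.Icc_prod_Icc]
    exact Set.prod_mono Set.Ioo_subset_Icc_self Set.Ioo_subset_Icc_self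
  let F : ℝ × ℝ → ℝ := fun p =>
    p.1 * (cos p.2 * P (polarPoint p.1 p.2) + sin p.2 * Q (polarPoint p.1 p.2))
  let G : ℝ × ℝ → ℝ := fun p =>
    cos p.2 * Q (polarPoint p.1 p.2) - sin p.2 * P (polarPoint p.1 p.2)
  have hF : ∀ p ∈ K, HasFDerivAt F _ p := fun p hp =>
    (h1 p).mul (((h2 p).cos.mul (hderiv hP p hp)).add ((h2 p).sin.mul (hderiv hQ p hp)))
  have hG : ∀ p ∈ K, HasFDerivAt G _ p := fun p hp =>
    ((h2 p).cos.mul (hderiv hQ p hp)).sub ((h2 p).sin.mul (hderiv hP p hp))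
  have hdiv : ∀ p ∈ K, fderiv ℝ F p (1, 0) + fderiv ℝ G p (0, 1) =
      p.1 * (fderiv ℝ P (polarPoint p.1 p.2) (EuclideanSpace.single 0 1) +
        fderiv ℝ Q (polarPoint p.1 p.2) (EuclideanSpace.single 1 1)) := by
    intro p hp
    rw [(hF p hp).fderiv, (hG p hp).fderiv]
    simp only [polarPointDeriv, polarPoint_eq_sum 1, polarPoint_eq_sum p.1 (p.2 + π / 2),
      _root_.add_apply, _root_.sub_apply, _root_.smul_apply,
      ContinuousLinearMap.comp_apply, ContinuousLinearMap.smulRight_apply,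
      ContinuousLinearMap.coe_fst', ContinuousLinearMap.coe_snd', map_add, map_smul, smul_eq_mul,
      cos_add_pi_div_two, sin_add_pi_div_two, zero_smul, one_smul, map_zero]
    linear_combination p.1 * (fderiv ℝ P (polarPoint p.1 p.2) (EuclideanSpace.single 0 1) +
        fderiv ℝ Q (polarPoint p.1 p.2) (EuclideanSpace.single 1 1)) * sin_sq_add_cos_sq p.2
  have hFc : ContinuousOn F K := fun p hp => (hF p hp).continuousAt.continuousWithinAt
  have hGc : ContinuousOn G K := fun p hp => (hG p hp).continuousAt.continuousWithinAt
  have hint : IntegrableOn (fun p => fderiv ℝ F p (1, 0) + fderiv ℝ G p (0, 1)) K := by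
    refine (ContinuousOn.congr ?_ hdiv).integrableOn_compact isCompact_Icc
    exact continuousOn_fst.mul ((hcomp (hfd hP _)).add (hcomp (hfd hQ _)))
  have key := integral_divergence_prod_Icc_of_hasFDerivAt_of_le F G (fderiv ℝ F) (fderiv ℝ G)
    (0, -π) (R, π) ⟨hR.le, by simp [pi_pos.le]⟩ hFc hGc
    (fun p hp => (hF p (hKo hp)).differentiableAt.hasFDerivAt)
    (fun p hp => (hG p (hKo hp)).differentiableAt.hasFDerivAt) hint
  rw [setIntegral_ball_eq_polar, ← setIntegral_congr_fun measurableSet_Icc hdiv, key,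
    integral_sphere_eq hR]
  · have hper : ∀ x, G (x, π) = G (x, -π) := fun x => by simp [G, polarPoint]
    have hzero : ∀ θ, F (0, θ) = 0 := fun θ => by simp [F]
    simp only [hper, hzero, sub_self, zero_add, intervalIntegral.integral_zero, sub_zero]
    refine intervalIntegral.integral_congr fun θ _ => ?_
    simp only [F, polarPoint, Matrix.cons_val_zero, Matrix.cons_val_one]
    field_simp
  · have hS : Metric.sphere (0 : EuclideanSpace ℝ (Fin 2)) R ⊆ U :=
      Metric.sphere_subset_closedBall.trans hB
    have hPs := hP.continuousOn.mono hS
    have hQs := hQ.continuousOn.mono hS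
    fun_prop

lemma inner_gradient_right_eq (g : EuclideanSpace ℝ (Fin 2) → ℝ) (v y : EuclideanSpace ℝ (Fin 2)) :
    ⟪v, gradient g y⟫ = v 0 * fderiv ℝ g y (EuclideanSpace.single 0 1) +
      v 1 * fderiv ℝ g y (EuclideanSpace.single 1 1) := by
  have hv : v = v 0 • EuclideanSpace.single 0 1 + v 1 • EuclideanSpace.single 1 1 := by
    ext i
    fin_cases i <;> simp
  rw [real_inner_comm, gradient, InnerProductSpace.toDual_symm_apply]
  conv_lhs => rw [hv]
  simp

lemma norm_gradient_sq_eq (g : EuclideanSpace ℝ (Fin 2) → ℝ) (y : EuclideanSpace ℝ (Fin 2)) :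
    ‖gradient g y‖ ^ 2 = fderiv ℝ g y (EuclideanSpace.single 0 1) ^ 2 +
      fderiv ℝ g y (EuclideanSpace.single 1 1) ^ 2 := by
  have h : ∀ i, gradient g y i = fderiv ℝ g y (EuclideanSpace.single i 1) := fun i => by
    rw [← InnerProductSpace.toDual_symm_apply, ← gradient, EuclideanSpace.inner_single_right]
    simp
  rw [EuclideanSpace.norm_sq_eq, Fin.sum_univ_two, h, h, Real.norm_eq_abs, Real.norm_eq_abs,
    sq_abs, sq_abs]

theorem pohozaev_identity (U : Set (EuclideanSpace ℝ (Fin 2))) (hU : IsOpen U)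
    (u a a₀ : EuclideanSpace ℝ (Fin 2) → ℝ) (f : ℝ → ℝ) (hf : Continuous f)
    (R : ℝ) (hR : 0 < R) (hB : Metric.closedBall (0 : EuclideanSpace ℝ (Fin 2)) R ⊆ U)
    (hu : ContDiffOn ℝ 2 u U) (ha : ContDiffOn ℝ 1 a U) (ha₀ : ContDiffOn ℝ 1 a₀ U)
    (heq : ∀ y ∈ U, -(laplacian2 u y) = a y * f (u y) + a₀ y) :
    (∫ y in Metric.ball (0 : EuclideanSpace ℝ (Fin 2)) R,
        (2 * (a y * (∫ s in (0:ℝ)..(u y), f s) + a₀ y * u y)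
          + ⟪y, gradient a y⟫ * (∫ s in (0:ℝ)..(u y), f s)
          + ⟪y, gradient a₀ y⟫ * u y))
      = ∫ y in Metric.sphere (0 : EuclideanSpace ℝ (Fin 2)) R,
          (⟪y, gradient u y⟫ * ⟪R⁻¹ • y, gradient u y⟫
            - ⟪y, R⁻¹ • y⟫ * ‖gradient u y‖ ^ 2 / 2
            + ⟪y, R⁻¹ • y⟫ * (a y * (∫ s in (0:ℝ)..(u y), f s) + a₀ y * u y))
          ∂(μH[1]) := by
  have hF : ∀ t, HasDerivAt (fun t => ∫ s in (0 : ℝ)..t, f s) (f t) t := fun t =>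
    (hf.integral_hasStrictDerivAt 0 t).hasDerivAt
  have hFu : ContDiffOn ℝ 1 (fun y => ∫ s in (0 : ℝ)..u y, f s) U := by
    have hF1 : ContDiff ℝ 1 fun t => ∫ s in (0 : ℝ)..t, f s := by
      rw [contDiff_one_iff_deriv, funext fun t => (hF t).deriv]
      exact ⟨fun t => (hF t).differentiableAt, hf⟩
    exact hF1.comp_contDiffOn (hu.of_le one_le_two)
  set F : ℝ → ℝ := fun t => ∫ s in (0 : ℝ)..t, f s
  let D : Fin 2 → EuclideanSpace ℝ (Fin 2) → ℝ := fun i y =>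
    fderiv ℝ u y (EuclideanSpace.single i 1)
  have hD : ∀ i, ContDiffOn ℝ 1 (D i) U := fun i =>
    (hu.fderiv_of_isOpen hU (by norm_num)).clm_apply contDiffOn_const
  let V : Fin 2 → EuclideanSpace ℝ (Fin 2) → ℝ := fun i y =>
    D i y * (y 0 * D 0 y + y 1 * D 1 y) - y i * (2⁻¹ * (D 0 y * D 0 y + D 1 y * D 1 y)) +
      y i * (a y * F (u y) + a₀ y * u y)
  have hc : ∀ i, ContDiffOn ℝ 1 (fun y : EuclideanSpace ℝ (Fin 2) => y i) U := fun i => by fun_prop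
  have hV : ∀ i, ContDiffOn ℝ 1 (V i) U := fun i =>
    (((hD i).mul (((hc 0).mul (hD 0)).add ((hc 1).mul (hD 1)))).sub ((hc i).mul
      (contDiffOn_const.mul (((hD 0).mul (hD 0)).add ((hD 1).mul (hD 1)))))).add
      ((hc i).mul ((ha.mul hFu).add (ha₀.mul (hu.of_le one_le_two))))
  have hdiff : ∀ {g : EuclideanSpace ℝ (Fin 2) → ℝ} {n : WithTop ℕ∞}, ContDiffOn ℝ n g U →
      n ≠ 0 → ∀ y ∈ U, HasFDerivAt g (fderiv ℝ g y) y := fun hg hn y hy =>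
    ((hg.differentiableOn hn).differentiableAt (hU.mem_nhds hy)).hasFDerivAt
  have hsymm : ∀ y ∈ U, fderiv ℝ (D 0) y (EuclideanSpace.single 1 1) =
      fderiv ℝ (D 1) y (EuclideanSpace.single 0 1) := by
    intro y hy
    have hd2 : DifferentiableAt ℝ (fderiv ℝ u) y :=
      ((hu.fderiv_of_isOpen hU (m := 1) (by norm_num)).differentiableOn
        one_ne_zero).differentiableAt (hU.mem_nhds hy)
    have hDf : ∀ i v, fderiv ℝ (D i) y v =
        fderiv ℝ (fderiv ℝ u) y v (EuclideanSpace.single i 1) := fun i v => by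
      simp only [D]
      rw [fderiv_clm_apply hd2 (differentiableAt_const _)]
      simp
    rw [hDf, hDf]
    exact ((hu.contDiffAt (hU.mem_nhds hy)).isSymmSndFDerivAt (by simp)).eq _ _
  have hdiv : ∀ y ∈ U, fderiv ℝ (V 0) y (EuclideanSpace.single 0 1) +
      fderiv ℝ (V 1) y (EuclideanSpace.single 1 1) =
      2 * (a y * F (u y) + a₀ y * u y) + ⟪y, gradient a y⟫ * F (u y)
          + ⟪y, gradient a₀ y⟫ * u y := by
    intro y hy
    have hy' : ∀ i, HasFDerivAt (fun y : EuclideanSpace ℝ (Fin 2) => y i)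
      (EuclideanSpace.proj i : EuclideanSpace ℝ (Fin 2) →L[ℝ] ℝ) y := fun i =>
      (EuclideanSpace.proj i : EuclideanSpace ℝ (Fin 2) →L[ℝ] ℝ).hasFDerivAt
    have hD' : ∀ i, HasFDerivAt (D i) _ y := fun i => hdiff (hD i) one_ne_zero y hy
    have hu' := hdiff hu two_ne_zero y hy
    have hFu' : HasFDerivAt (fun y => F (u y)) _ y := (hF (u y)).comp_hasFDerivAt y hu'
    have hV' : ∀ i, HasFDerivAt (V i) _ y := fun i =>
      (((hD' i).mul (((hy' 0).mul (hD' 0)).add ((hy' 1).mul (hD' 1)))).sub ((hy' i).mul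
        ((((hD' 0).mul (hD' 0)).add ((hD' 1).mul (hD' 1))).const_mul 2⁻¹))).add
        ((hy' i).mul (((hdiff ha one_ne_zero y hy).mul hFu').add
          ((hdiff ha₀ one_ne_zero y hy).mul hu')))
    have hlap := heq y hy
    rw [laplacian2, Fin.sum_univ_two] at hlap
    change -(fderiv ℝ (D 0) y _ + fderiv ℝ (D 1) y _) = _ at hlap
    rw [(hV' 0).fderiv, (hV' 1).fderiv, inner_gradient_right_eq, inner_gradient_right_eq]
    have hs := hsymm y hy
    have hDu : ∀ i, fderiv ℝ u y (EuclideanSpace.single i 1) = D i y := fun i => rfl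
    simp only [_root_.add_apply, _root_.sub_apply, _root_.smul_apply, smul_eq_mul,
      Pi.add_apply, Pi.mul_apply, PiLp.proj_apply, PiLp.single_apply, ↓reduceIte, zero_ne_one,
      one_ne_zero, hs, hDu]
    linear_combination -(y 0 * D 0 y + y 1 * D 1 y) * hlap
  rw [← setIntegral_congr_fun Metric.isOpen_ball.measurableSet
      (fun y hy => hdiv y (hB (Metric.ball_subset_closedBall hy))),
    integral_ball_divergence hU hR hB (hV 0) (hV 1)]
  refine setIntegral_congr_fun Metric.isClosed_sphere.measurableSet fun y _ => ?_
  have hyy : ⟪y, R⁻¹ • y⟫ = R⁻¹ * (y 0 ^ 2 + y 1 ^ 2) := by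
    rw [real_inner_smul_right, real_inner_self_eq_norm_sq, EuclideanSpace.norm_sq_eq,
      Fin.sum_univ_two, Real.norm_eq_abs, Real.norm_eq_abs, sq_abs, sq_abs]
  simp only [hyy, real_inner_smul_left, inner_gradient_right_eq, norm_gradient_sq_eq, V, D]
  ring
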